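/- arXiv:2103.14827 — 2 statements merged into one kernel-verified Lean document; each statement's English description precedes it below -/
import Mathlib

section
/- Let n, d ≥ 1 and let A, B, C, D be n×n block Toeplitz matrices with d×d complex blocks, with symbols a, b, c, d : {−(n−1), …, n−1} → M_d(ℂ) (so A_{i,j} = a(i−j), etc.). Then AB − CD is a block Toeplitz matrix if and only if for all 1 ≤ i, j ≤ n−1: a(−i)·b(j) − a(n−i)·b(j−n) = c(−i)·d(j) − c(n−i)·d(j−n). -/
open Matrix

/-- Entries `k = 0, …, n - 1` of a Toeplitz product, shifted one step down the diagonal. -/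
theorem sum_toeplitz_mul_shift {R : Type*} [Ring R] (a b : ℤ → R) (n : ℕ) (i j : ℤ) :
    ∑ k ∈ Finset.range n, a (i + 1 - k) * b (k - (j + 1)) -
        ∑ k ∈ Finset.range n, a (i - k) * b (k - j) =
      a (i + 1) * b (-(j + 1)) - a (i + 1 - n) * b (n - (j + 1)) := by
  have h := (Finset.sum_range_succ (fun k : ℕ => a (i + 1 - k) * b (k - (j + 1))) n).symm.trans
    (Finset.sum_range_succ' _ n)
  have hshift : ∀ k : ℕ, a (i + 1 - ((k + 1 : ℕ) : ℤ)) * b (((k + 1 : ℕ) : ℤ) - (j + 1)) =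
      a (i - k) * b (k - j) := fun k => by
    congr 2 <;> push_cast <;> ring
  simp only [hshift, Nat.cast_zero, sub_zero, zero_sub] at h
  rw [sub_eq_sub_iff_add_eq_add, h, add_comm]

/-- A square array is constant along diagonals iff consecutive diagonal entries agree. -/
theorem diagonal_constant_iff_succ {α : Type*} (n : ℕ) (F : ℤ → ℤ → α) :
    (∀ i j i' j' : Fin n, (i : ℤ) - (j : ℤ) = (i' : ℤ) - (j' : ℤ) → F i j = F i' j') ↔
      ∀ i j : ℕ, i + 1 < n → j + 1 < n → F (i + 1) (j + 1) = F i j := by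
  constructor
  · intro h i j hi hj
    have := h ⟨i + 1, hi⟩ ⟨j + 1, hj⟩ ⟨i, by omega⟩ ⟨j, by omega⟩ (by push_cast; ring)
    simpa using this
  · intro h
    have key : ∀ k i j : ℕ, i + k < n → j + k < n →
        F ((i + k : ℕ) : ℤ) ((j + k : ℕ) : ℤ) = F i j := by
      intro k
      induction k with
      | zero => intros; rfl
      | succ k ih =>
        intro i j hi hj
        rw [← ih i j (by omega) (by omega), ← h (i + k) (j + k) hi hj]
        push_cast
        simp only [add_assoc]
    rintro ⟨i, hi⟩ ⟨j, hj⟩ ⟨i', hi'⟩ ⟨j', hj'⟩ hij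
    dsimp only at hij ⊢
    rcases le_total i i' with hle | hle
    · obtain ⟨k, rfl⟩ := Nat.exists_eq_add_of_le hle
      obtain rfl : j' = j + k := by omega
      exact (key k i j hi' hj').symm
    · obtain ⟨k, rfl⟩ := Nat.exists_eq_add_of_le hle
      obtain rfl : j = j' + k := by omega
      exact key k i' j' hi hj

/-- For block Toeplitz matrices `A, B, C, D` with symbols `a, b, c, d'`,
`AB − CD` is block Toeplitz iff
`a(−i)·b(j) − a(n−i)·b(j−n) = c(−i)·d(j) − c(n−i)·d(j−n)` for all `1 ≤ i, j ≤ n−1`. -/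
theorem product_difference_toeplitz_iff (n d : ℕ) (hn : 1 ≤ n) (hd : 1 ≤ d)
    (a b c d' : ℤ → Matrix (Fin d) (Fin d) ℂ)
    (A B C D : Matrix (Fin n) (Fin n) (Matrix (Fin d) (Fin d) ℂ))
    (hA : ∀ i j : Fin n, A i j = a ((i : ℤ) - (j : ℤ)))
    (hB : ∀ i j : Fin n, B i j = b ((i : ℤ) - (j : ℤ)))
    (hC : ∀ i j : Fin n, C i j = c ((i : ℤ) - (j : ℤ)))
    (hD : ∀ i j : Fin n, D i j = d' ((i : ℤ) - (j : ℤ))) :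
    (∀ i j i' j' : Fin n, (i : ℤ) - (j : ℤ) = (i' : ℤ) - (j' : ℤ) →
        (A * B - C * D) i j = (A * B - C * D) i' j') ↔
      ∀ i j : Fin n, 1 ≤ (i : ℕ) → 1 ≤ (j : ℕ) →
        a (-(i : ℤ)) * b (j : ℤ) - a ((n : ℤ) - (i : ℤ)) * b ((j : ℤ) - (n : ℤ)) =
          c (-(i : ℤ)) * d' (j : ℤ) - c ((n : ℤ) - (i : ℤ)) * d' ((j : ℤ) - (n : ℤ)) := by
  let P (f g : ℤ → Matrix (Fin d) (Fin d) ℂ) (i j : ℤ) : Matrix (Fin d) (Fin d) ℂ :=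
    ∑ k ∈ Finset.range n, f (i - k) * g (k - j)
  have hM : ∀ i j : Fin n, (A * B - C * D) i j = P a b i j - P c d' i j := fun i j => by
    simp only [Matrix.sub_apply, Matrix.mul_apply, hA, hB, hC, hD, P, Finset.sum_range]
  simp only [hM]
  rw [diagonal_constant_iff_succ n fun i j => P a b i j - P c d' i j]
  have hstep : ∀ i j : ℤ,
      P a b (i + 1) (j + 1) - P c d' (i + 1) (j + 1) = P a b i j - P c d' i j ↔
        a (i + 1 - n) * b (n - (j + 1)) - a (i + 1) * b (-(j + 1)) =
          c (i + 1 - n) * d' (n - (j + 1)) - c (i + 1) * d' (-(j + 1)) := fun i j => by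
    rw [sub_eq_sub_iff_sub_eq_sub, sum_toeplitz_mul_shift, sum_toeplitz_mul_shift,
      ← neg_inj, neg_sub, neg_sub]
  simp only [hstep]
  constructor
  · rintro h ⟨i, hi⟩ ⟨j, hj⟩ h1i h1j
    dsimp only at h1i h1j ⊢
    have := h (n - 1 - i) (n - 1 - j) (by omega) (by omega)
    rw [show ((n - 1 - i : ℕ) : ℤ) + 1 = n - i by omega,
      show ((n - 1 - j : ℕ) : ℤ) + 1 = n - j by omega] at this
    simpa using this
  · intro h i j hi hj
    have := h ⟨n - (i + 1), by omega⟩ ⟨n - (j + 1), by omega⟩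
      (Nat.sub_pos_of_lt hi) (Nat.sub_pos_of_lt hj)
    simpa [Nat.cast_sub hi.le, Nat.cast_sub hj.le] using this
end

section
/- Let n, d ≥ 1 and let A, B be n×n block Toeplitz matrices with d×d complex blocks, with symbols a, b : {−(n−1), …, n−1} → M_d(ℂ) (so A_{i,j} = a(i−j), B_{i,j} = b(i−j)). Then the product AB is a block Toeplitz matrix if and only if for all 1 ≤ i, j ≤ n−1: a(−i)·b(j) = a(n−i)·b(j−n). -/
open Matrix

/-- Shifting both indices of a product of Toeplitz symbols changes it by two boundary terms. -/
theorem toeplitz_sum_shift {R : Type*} [Ring R] (a b : ℤ → R) (n : ℕ) (i j : ℤ) :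
    (∑ k ∈ Finset.range n, a (i + 1 - k) * b (k - (j + 1))) + a (i + 1 - n) * b (n - (j + 1)) =
      (∑ k ∈ Finset.range n, a (i - k) * b (k - j)) + a (i + 1) * b (-(j + 1)) := by
  rw [← Finset.sum_range_succ (fun k : ℕ => a (i + 1 - k) * b (k - (j + 1))),
    Finset.sum_range_succ']
  congr 1
  · refine Finset.sum_congr rfl fun k _ => ?_
    congr 2 <;> push_cast <;> ring
  · simp

theorem toeplitz_sum_shift_eq_iff {R : Type*} [Ring R] (a b : ℤ → R) (n : ℕ) (i j : ℤ) :
    (∑ k ∈ Finset.range n, a (i + 1 - k) * b (k - (j + 1))) =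
        (∑ k ∈ Finset.range n, a (i - k) * b (k - j)) ↔
      a (i + 1 - n) * b (n - (j + 1)) = a (i + 1) * b (-(j + 1)) := by
  have h := toeplitz_sum_shift a b n i j
  constructor
  · intro e
    rwa [e, add_right_inj] at h
  · intro e
    rwa [e, add_left_inj] at h

/-- For block Toeplitz matrices `A, B` with symbols `a, b`, the product `AB` is
block Toeplitz iff `a(−i)·b(j) = a(n−i)·b(j−n)` for all `1 ≤ i, j ≤ n−1`. -/
theorem product_toeplitz_iff (n d : ℕ) (hn : 1 ≤ n) (hd : 1 ≤ d)
    (a b : ℤ → Matrix (Fin d) (Fin d) ℂ)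
    (A B : Matrix (Fin n) (Fin n) (Matrix (Fin d) (Fin d) ℂ))
    (hA : ∀ i j : Fin n, A i j = a ((i : ℤ) - (j : ℤ)))
    (hB : ∀ i j : Fin n, B i j = b ((i : ℤ) - (j : ℤ))) :
    (∀ i j i' j' : Fin n, (i : ℤ) - (j : ℤ) = (i' : ℤ) - (j' : ℤ) →
        (A * B) i j = (A * B) i' j') ↔
      ∀ i j : Fin n, 1 ≤ (i : ℕ) → 1 ≤ (j : ℕ) →
        a (-(i : ℤ)) * b (j : ℤ) = a ((n : ℤ) - (i : ℤ)) * b ((j : ℤ) - (n : ℤ)) := by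
  have hP : ∀ i j : Fin n, (A * B) i j =
      ∑ k ∈ Finset.range n, a ((i : ℤ) - k) * b ((k : ℤ) - j) := fun i j => by
    rw [Matrix.mul_apply,
      ← Fin.sum_univ_eq_sum_range (fun k : ℕ => a ((i : ℤ) - k) * b ((k : ℤ) - j))]
    simp only [hA, hB]
  simp only [hP]
  constructor
  · intro h i j hi hj
    have hs := h ⟨n - i, by omega⟩ ⟨n - j, by omega⟩ ⟨n - i - 1, by omega⟩ ⟨n - j - 1, by omega⟩
      (by dsimp only; omega)
    dsimp only at hs
    rw [show ((n - i : ℕ) : ℤ) = ((n - i - 1 : ℕ) : ℤ) + 1 by omega,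
      show ((n - j : ℕ) : ℤ) = ((n - j - 1 : ℕ) : ℤ) + 1 by omega,
      toeplitz_sum_shift_eq_iff] at hs
    convert hs using 3 <;> first | rfl | omega
  · intro h
    have shift : ∀ m i j : ℕ, i + m < n → j + m < n →
        (∑ k ∈ Finset.range n, a (((i + m : ℕ) : ℤ) - k) * b ((k : ℤ) - ((j + m : ℕ) : ℤ))) =
          ∑ k ∈ Finset.range n, a ((i : ℤ) - k) * b ((k : ℤ) - j) := by
      intro m i j
      induction m with
      | zero => intros; rfl
      | succ m ih =>
        intro hi hj
        rw [← ih (by omega) (by omega), ← add_assoc, ← add_assoc, Nat.cast_succ (i + m),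
          Nat.cast_succ (j + m), toeplitz_sum_shift_eq_iff]
        have hs := h ⟨n - (i + m + 1), by omega⟩ ⟨n - (j + m + 1), by omega⟩
          (by dsimp only; omega) (by dsimp only; omega)
        dsimp only at hs
        convert hs using 3 <;> first | rfl | omega
    intro i j i' j' hij
    rcases le_total (i : ℕ) i' with hle | hle
    · have hs := shift (i' - i) i j (by omega) (by omega)
      rw [show (i : ℕ) + (i' - i) = i' by omega, show (j : ℕ) + (i' - i) = j' by omega] at hs
      exact hs.symm
    · have hs := shift (i - i') i' j' (by omega) (by omega)
      rwa [show (i' : ℕ) + (i - i') = i by omega, show (j' : ℕ) + (i - i') = j by omega] at hs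
end
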